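/- arXiv:math/0403315 — 6 statements merged into one kernel-verified Lean document; each statement's English description precedes it below -/
import Mathlib

section
/- Let Λ be a dominant regular integral weight for gl(m|n) with degree of atypicality r, and let 1 ≤ s ≤ t ≤ r. Then the distance d_{s,t}(Λ) := h_t(Λ) − h_s(Λ) = Λ_{m_t} − Λ_{m_s} − n_t + n_s + t − s equals the number of integers k with Λ^ρ_{n̄_s} ≤ k ≤ Λ^ρ_{n̄_t} that do not occur as an entry of Λ^ρ; in particular d_{s,t}(Λ) ≥ 0. -/
open scoped Classical

noncomputable section

namespace SuZhang

/-- Integral weights of `gl(m|n)`, as pairs (even entries | odd entries). -/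
abbrev Wt (m n : ℕ) := (Fin m → ℤ) × (Fin n → ℤ)

/-- ρ-shifted even entries: `Λ^ρ_i = Λ_i + (m+1-i)` (1-indexed). -/
def rE (m : ℕ) (we : Fin m → ℤ) (i : Fin m) : ℤ := we i + (m : ℤ) - (i : ℤ)

/-- ρ-shifted odd entries: `Λ^ρ_{n̄_ζ} = Λ_{n̄_ζ} + ζ` (1-indexed). -/
def rD {n : ℕ} (wd : Fin n → ℤ) (ζ : Fin n) : ℤ := wd ζ + (ζ : ℤ) + 1

/-- Regularity: the ρ-shifted even entries are pairwise distinct, and likewise the odd ones. -/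
def Regular (m : ℕ) {n : ℕ} (we : Fin m → ℤ) (wd : Fin n → ℤ) : Prop :=
  Function.Injective (rE m we) ∧ Function.Injective (rD wd)

/-- Dominance: even entries nonincreasing, odd entries nondecreasing. -/
def Dominant (m : ℕ) {n : ℕ} (we : Fin m → ℤ) (wd : Fin n → ℤ) : Prop :=
  (∀ i j : Fin m, i ≤ j → we j ≤ we i) ∧ (∀ ζ η : Fin n, ζ ≤ η → wd ζ ≤ wd η)

/-- `(mI, nI)` is the enumeration of the `r` atypical roots
`γ_s = ε_{m_s} - δ_{n_s}` of the weight, with `m_r < ... < m_1`, `n_1 < ... < n_r`.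
Its existence asserts that the degree of atypicality is exactly `r`. -/
structure Enum (m n r : ℕ) (we : Fin m → ℤ) (wd : Fin n → ℤ)
    (mI : Fin r → Fin m) (nI : Fin r → Fin n) : Prop where
  atyp : ∀ s, rE m we (mI s) = rD wd (nI s)
  mAnti : ∀ s t : Fin r, s < t → mI t < mI s
  nMono : ∀ s t : Fin r, s < t → nI s < nI t
  complete : ∀ (i : Fin m) (ζ : Fin n), rE m we i = rD wd ζ → ∃ s, mI s = i ∧ nI s = ζ

/-- The height `h_s(Λ) = Λ_{m_s} - n_s + s` (1-indexed `n_s`, `s`). -/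
def height {m n r : ℕ} (we : Fin m → ℤ)
    (mI : Fin r → Fin m) (nI : Fin r → Fin n) (s : Fin r) : ℤ :=
  we (mI s) - ((nI s : ℕ) : ℤ) + ((s : ℕ) : ℤ)

/-- `k` occurs as an entry of `Λ^ρ`. -/
def IsEntry (m : ℕ) {n : ℕ} (we : Fin m → ℤ) (wd : Fin n → ℤ) (k : ℤ) : Prop :=
  (∃ i, rE m we i = k) ∨ (∃ ζ, rD wd ζ = k)

/-- `k` occurs as an entry of the typical tuple `typ_Λ`. -/
def IsTypEntry (m : ℕ) {n r : ℕ} (we : Fin m → ℤ) (wd : Fin n → ℤ)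
    (mI : Fin r → Fin m) (nI : Fin r → Fin n) (k : ℤ) : Prop :=
  (∃ i, (∀ s, mI s ≠ i) ∧ rE m we i = k) ∨ (∃ ζ, (∀ s, nI s ≠ ζ) ∧ rD wd ζ = k)

/-- The number of integers in `[a, b]` *not* satisfying `P`. -/
def countNotIn (a b : ℤ) (P : ℤ → Prop) : ℕ :=
  ((Finset.Icc a b).filter fun k => ¬ P k).card

/-- `c^Λ_{s,t} = 1` (for `s ≤ t`): `s = t` or `Λ_{m_t} - Λ_{m_s} < n_t - n_s`. -/
def cRel {m n r : ℕ} (we : Fin m → ℤ) (mI : Fin r → Fin m) (nI : Fin r → Fin n)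
    (s t : Fin r) : Prop :=
  s = t ∨ we (mI t) - we (mI s) < ((nI t : ℕ) : ℤ) - ((nI s : ℕ) : ℤ)

/-- `d^Λ_{s,t} = 1`: `c^Λ_{s,p} = 1` for all `s ≤ p ≤ t`. -/
def dRel {m n r : ℕ} (we : Fin m → ℤ) (mI : Fin r → Fin m) (nI : Fin r → Fin n)
    (s t : Fin r) : Prop :=
  ∀ p, s ≤ p → p ≤ t → cRel we mI nI s p

/-- Number of inversions `ℓ(σ)` of a permutation. -/
def invCount {r : ℕ} (σ : Equiv.Perm (Fin r)) : ℕ :=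
  (Finset.univ.filter fun p : Fin r × Fin r => p.1 < p.2 ∧ σ p.2 < σ p.1).card

/-- `S^Λ = {σ : σ⁻¹(s) < σ⁻¹(t) whenever s < t and d^Λ_{s,t} = 1}`. -/
def SLam {m n r : ℕ} (we : Fin m → ℤ) (mI : Fin r → Fin m) (nI : Fin r → Fin n) :
    Set (Equiv.Perm (Fin r)) :=
  {σ | ∀ s t : Fin r, s < t → dRel we mI nI s t → σ⁻¹ s < σ⁻¹ t}

/-- `typ_Λ = typ_λ` : equality of the typical tuples (for dominant/sorted weights,
equality of ordered tuples is equality of the even and odd typical entry sets). -/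
def TypEq (m n r : ℕ) (Le : Fin m → ℤ) (Ld : Fin n → ℤ)
    (mI : Fin r → Fin m) (nI : Fin r → Fin n)
    (le : Fin m → ℤ) (ld : Fin n → ℤ)
    (mI' : Fin r → Fin m) (nI' : Fin r → Fin n) : Prop :=
  (∀ k : ℤ, (∃ i, (∀ s, mI s ≠ i) ∧ rE m Le i = k) ↔ (∃ i, (∀ s, mI' s ≠ i) ∧ rE m le i = k)) ∧
  (∀ k : ℤ, (∃ ζ, (∀ s, nI s ≠ ζ) ∧ rD Ld ζ = k) ↔ (∃ ζ, (∀ s, nI' s ≠ ζ) ∧ rD ld ζ = k))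

/-- `λ ≼ Λ` : equal typical tuples, and `aty_λ ≤ aty_Λ` entrywise. -/
def Prec (m n r : ℕ) (le : Fin m → ℤ) (ld : Fin n → ℤ)
    (mI' : Fin r → Fin m) (nI' : Fin r → Fin n)
    (Le : Fin m → ℤ) (Ld : Fin n → ℤ)
    (mI : Fin r → Fin m) (nI : Fin r → Fin n) : Prop :=
  TypEq m n r Le Ld mI nI le ld mI' nI' ∧ ∀ s, rD ld (nI' s) ≤ rD Ld (nI s)

/-- `σ ∈ S̃^{Λ,λ}`, i.e. `λ ≼ σ·Λ` where `σ·Λ` is the dot action permuting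
the atypical entries of `Λ^ρ`. -/
def STildeMem (m n r : ℕ) (le : Fin m → ℤ) (ld : Fin n → ℤ)
    (mI' : Fin r → Fin m) (nI' : Fin r → Fin n)
    (Le : Fin m → ℤ) (Ld : Fin n → ℤ)
    (mI : Fin r → Fin m) (nI : Fin r → Fin n) (σ : Equiv.Perm (Fin r)) : Prop :=
  TypEq m n r Le Ld mI nI le ld mI' nI' ∧ ∀ s, rD ld (nI' s) ≤ rD Ld (nI (σ s))

/-- The weight is lexical: its atypical tuple is nondecreasing. -/
def Lexical {n r : ℕ} (wd : Fin n → ℤ) (nI : Fin r → Fin n) : Prop :=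
  Monotone fun s : Fin r => rD wd (nI s)

/-- The typical tuple is sorted:  its first `m - r` entries (the even ones) are strictly
decreasing and its last `n - r` entries (the odd ones) are strictly increasing. -/
def TypSorted (m n r : ℕ) (we : Fin m → ℤ) (wd : Fin n → ℤ)
    (mI : Fin r → Fin m) (nI : Fin r → Fin n) : Prop :=
  (∀ i j : Fin m, (∀ s, mI s ≠ i) → (∀ s, mI s ≠ j) → i < j → rE m we j < rE m we i) ∧
  (∀ ζ η : Fin n, (∀ s, nI s ≠ ζ) → (∀ s, nI s ≠ η) → ζ < η → rD wd ζ < rD wd η)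

/-- Add `c_s` to the entry in position `idx s`, for each `s`. -/
def addV {N r : ℕ} (w : Fin N → ℤ) (idx : Fin r → Fin N) (c : Fin r → ℤ) : Fin N → ℤ :=
  fun i => w i + ∑ s, if idx s = i then c s else 0

/-- The integers `k_s` of Definition 3.8: `k_s` is the smallest positive integer such that
`(Λ + θ_t k_t γ_t) + k_s γ_s` is regular for all `t > s` and `θ_t ∈ {0,1}`. -/
def kmin (m n r : ℕ) (mI : Fin r → Fin m) (nI : Fin r → Fin n)
    (we : Fin m → ℤ) (wd : Fin n → ℤ) (s : Fin r) : ℕ :=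
  sInf {c : ℕ | 0 < c ∧ ∀ t : Fin r, s < t → ∀ θ : ℕ, θ ≤ 1 →
    Regular m
      (addV we mI fun u =>
        (if u = t then (θ : ℤ) * (kmin m n r mI nI we wd t : ℤ) else 0) +
        (if u = s then (c : ℤ) else 0))
      (addV wd nI fun u =>
        (if u = t then (θ : ℤ) * (kmin m n r mI nI we wd t : ℤ) else 0) +
        (if u = s then (c : ℤ) else 0))}
termination_by r - (s : ℕ)
decreasing_by
  all_goals
    simp only [Fin.lt_def] at *
    have := t.isLt
    omega

/-- The raising operator `R_{m_s, n̄_s}`. -/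
def raise (m n r : ℕ) (mI : Fin r → Fin m) (nI : Fin r → Fin n) (s : Fin r)
    (w : Wt m n) : Wt m n :=
  (addV w.1 mI fun u => if u = s then (kmin m n r mI nI w.1 w.2 s : ℤ) else 0,
   addV w.2 nI fun u => if u = s then (kmin m n r mI nI w.1 w.2 s : ℤ) else 0)

/-- `R_1^{θ_1} ∘ ⋯ ∘ R_r^{θ_r}` applied to a weight (rightmost factor applied first). -/
def applyAll (m n r : ℕ) (mI : Fin r → Fin m) (nI : Fin r → Fin n)
    (θ : Fin r → ℕ) (w : Wt m n) : Wt m n :=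
  (List.finRange r).foldr (fun s v => (raise m n r mI nI s)^[θ s] v) w

/-- `v = w(μ + ρ) - ρ` for some `w ∈ W = Sym_m × Sym_n`. -/
def DotConj (m n : ℕ) (w v : Wt m n) : Prop :=
  ∃ (πe : Equiv.Perm (Fin m)) (πd : Equiv.Perm (Fin n)),
    (∀ i, rE m v.1 i = rE m w.1 (πe i)) ∧ (∀ ζ, rD v.2 ζ = rD w.2 (πd ζ))

/-- `Θ^Λ_λ = {θ ∈ ℕ^r : R'_θ(λ) = Λ}` (for dominant `Λ`). -/
def ThetaSet (m n r : ℕ) (mI' : Fin r → Fin m) (nI' : Fin r → Fin n)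
    (lw Lw : Wt m n) : Set (Fin r → ℕ) :=
  {θ | DotConj m n (applyAll m n r mI' nI' θ lw) Lw}

/-- The generalized Kazhdan–Lusztig polynomial
`K_{Λ,λ}(q) = Σ_{θ ∈ Θ^Λ_λ} q^{|θ|}`, as a Laurent polynomial. -/
def KL (m n r : ℕ) (mI' : Fin r → Fin m) (nI' : Fin r → Fin n)
    (lw Lw : Wt m n) : LaurentPolynomial ℤ :=
  ∑ᶠ θ ∈ ThetaSet m n r mI' nI' lw Lw, LaurentPolynomial.T (∑ s, (θ s : ℤ))

/-- `ℓ(Λ, λ) = Σ_s (h_s(Λ) - h_s(λ))`. -/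
def lenDiff {m n r : ℕ} (Le : Fin m → ℤ) (mI : Fin r → Fin m) (nI : Fin r → Fin n)
    (le : Fin m → ℤ) (mI' : Fin r → Fin m) (nI' : Fin r → Fin n) : ℤ :=
  ∑ s : Fin r, (height Le mI nI s - height le mI' nI' s)

/-- `σ = σ_θ`: the permutation associated with `θ ∈ Θ^Λ_λ`, determined by
`(λ^{(0)})^ρ_{n̄'_s} = Λ^ρ_{n̄_{σ(s)}}` where `λ^{(0)} = R_1^{θ_1} ∘ ⋯ ∘ R_r^{θ_r}(λ)`. -/
def IsSigma (m n r : ℕ) (mI' : Fin r → Fin m) (nI' : Fin r → Fin n)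
    (lw : Wt m n) (Ld : Fin n → ℤ) (nI : Fin r → Fin n)
    (θ : Fin r → ℕ) (σ : Equiv.Perm (Fin r)) : Prop :=
  ∀ s, rD (applyAll m n r mI' nI' θ lw).2 (nI' s) = rD Ld (nI (σ s))

/-- The polynomials `Z_q(x; b)` of Definition 3.25. -/
def Zq : (N : ℕ) → (Fin N → ℤ) → (Fin N → ℤ) → Polynomial ℤ
  | 0, _, _ => 1
  | (N + 1), x, b =>
    if Monotone x ∧ Monotone b ∧ (∀ s : Fin (N + 1), 1 ≤ b s ∧ b s ≤ (s : ℕ) + 1) then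
      Zq N (fun j => x j.castSucc) (fun j => b j.castSucc) +
      ∑ i ∈ Finset.univ.filter (fun i : Fin N => b (Fin.last N) ≤ ((i : ℕ) : ℤ) + 1),
        (if x i.castSucc < x i.succ then
          Zq N (fun j => if (j : ℕ) < (i : ℕ) then x j.castSucc else x j.succ - 1)
               (fun j => b j.castSucc) * Polynomial.X ^ (N - (i : ℕ))
         else 0)
    else 0

/-- `c^x_{s,t}` for a plain tuple `x`. -/
def cX {r : ℕ} (x : Fin r → ℤ) (s t : Fin r) : Prop :=
  t = s ∨ x t - x s < ((t : ℕ) : ℤ) - ((s : ℕ) : ℤ)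

/-- `d^x_{s,t}` for a plain tuple `x`. -/
def dX {r : ℕ} (x : Fin r → ℤ) (s t : Fin r) : Prop :=
  ∀ p, s ≤ p → p ≤ t → cX x s p

/-- `x̂_s = #{p < s : d^x_{p,s} = 0}`. -/
def xhat {r : ℕ} (x : Fin r → ℤ) (s : Fin r) : ℤ :=
  ((Finset.univ.filter fun p : Fin r => p < s ∧ ¬ dX x p s).card : ℤ)


/-- the distance `d_{s,t}(Λ) = h_t(Λ) - h_s(Λ)` equals the number of integers
between the `s`-th and `t`-th atypical entries of `Λ^ρ` that are not entries of `Λ^ρ`;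
in particular it is nonnegative. -/
theorem statement0 (m n r : ℕ) (hm : 1 ≤ m) (hn : 1 ≤ n)
    (we : Fin m → ℤ) (wd : Fin n → ℤ)
    (hdom : Dominant m we wd) (hreg : Regular m we wd)
    (mI : Fin r → Fin m) (nI : Fin r → Fin n) (hEnum : Enum m n r we wd mI nI)
    (s t : Fin r) (hst : s ≤ t) :
    height we mI nI t - height we mI nI s
        = we (mI t) - we (mI s) - ((nI t : ℕ) : ℤ) + ((nI s : ℕ) : ℤ)
          + ((t : ℕ) : ℤ) - ((s : ℕ) : ℤ)
    ∧ height we mI nI t - height we mI nI s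
        = ((countNotIn (rD wd (nI s)) (rD wd (nI t)) (IsEntry m we wd) : ℕ) : ℤ)
    ∧ 0 ≤ height we mI nI t - height we mI nI s := by
  have hE : StrictAnti (rE m we) := by
    intro i j hij
    have h1 := hdom.1 i j hij.le
    have h2 : (i : ℕ) < (j : ℕ) := hij
    unfold rE
    omega
  have hD : StrictMono (rD wd) := by
    intro i j hij
    have h1 := hdom.2 i j hij.le
    have h2 : (i : ℕ) < (j : ℕ) := hij
    unfold rD
    omega
  have hN : StrictMono nI := fun a b h => hEnum.nMono a b h
  have hM : StrictAnti mI := fun a b h => hEnum.mAnti a b h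
  have key : height we mI nI t - height we mI nI s
        = ((countNotIn (rD wd (nI s)) (rD wd (nI t)) (IsEntry m we wd) : ℕ) : ℤ) := by
    set A := (Finset.Icc (mI t) (mI s)).image (rE m we) with hA
    set B := (Finset.Icc (nI s) (nI t)).image (rD wd) with hB
    have hAc : A.card = (mI s : ℕ) + 1 - (mI t : ℕ) := by
      rw [hA, Finset.card_image_of_injective _ hE.injective, Fin.card_Icc]
    have hBc : B.card = (nI t : ℕ) + 1 - (nI s : ℕ) := by
      rw [hB, Finset.card_image_of_injective _ hD.injective, Fin.card_Icc]
    have hAB : A ∩ B = (Finset.Icc s t).image (fun p => rD wd (nI p)) := by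
      ext k
      simp only [hA, hB, Finset.mem_inter, Finset.mem_image, Finset.mem_Icc]
      constructor
      · rintro ⟨⟨i, hi, rfl⟩, ⟨z, hz, hzi⟩⟩
        obtain ⟨p, rfl, rfl⟩ := hEnum.complete i z hzi.symm
        exact ⟨p, ⟨hN.le_iff_le.1 hz.1, hN.le_iff_le.1 hz.2⟩, hzi⟩
      · rintro ⟨p, ⟨h1, h2⟩, rfl⟩
        exact ⟨⟨mI p, ⟨hM.antitone h2, hM.antitone h1⟩, hEnum.atyp p⟩,
          ⟨nI p, ⟨hN.monotone h1, hN.monotone h2⟩, rfl⟩⟩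
    have hABc : (A ∩ B).card = (t : ℕ) + 1 - (s : ℕ) := by
      rw [hAB, Finset.card_image_of_injective _ (fun a b h => hN.injective (hD.injective h)),
        Fin.card_Icc]
    have hU : (Finset.Icc (rD wd (nI s)) (rD wd (nI t))).filter (fun k => IsEntry m we wd k)
        = A ∪ B := by
      ext k
      rw [Finset.mem_filter]
      simp only [hA, hB, Finset.mem_union, Finset.mem_image, Finset.mem_Icc, IsEntry]
      constructor
      · rintro ⟨⟨h1, h2⟩, ⟨i, rfl⟩ | ⟨z, rfl⟩⟩
        · left
          rw [← hEnum.atyp, hE.le_iff_ge] at h1 h2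
          exact ⟨i, ⟨h2, h1⟩, rfl⟩
        · right
          exact ⟨z, ⟨hD.le_iff_le.1 h1, hD.le_iff_le.1 h2⟩, rfl⟩
      · rintro (⟨i, ⟨h1, h2⟩, rfl⟩ | ⟨z, ⟨h1, h2⟩, rfl⟩)
        · refine ⟨?_, Or.inl ⟨i, rfl⟩⟩
          rw [← hEnum.atyp, ← hEnum.atyp]
          exact ⟨hE.antitone h2, hE.antitone h1⟩
        · exact ⟨⟨hD.monotone h1, hD.monotone h2⟩, Or.inr ⟨z, rfl⟩⟩
    have hsum := Finset.card_filter_add_card_filter_not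
      (s := Finset.Icc (rD wd (nI s)) (rD wd (nI t))) (fun k => IsEntry m we wd k)
    rw [hU, Int.card_Icc] at hsum
    have hui := Finset.card_union_add_card_inter A B
    have h1 : (s : ℕ) ≤ t := hst
    have h2 : (nI s : ℕ) ≤ nI t := hN.monotone hst
    have h3 : (mI t : ℕ) ≤ mI s := hM.antitone hst
    have h4 : rD wd (nI s) ≤ rD wd (nI t) := hD.monotone (hN.monotone hst)
    have h5 := hEnum.atyp s
    have h6 := hEnum.atyp t
    unfold countNotIn height
    unfold rE at h5 h6
    omega
  refine ⟨?_, key, ?_⟩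
  · unfold height
    ring
  · rw [key]
    positivity
end SuZhang
end
end

section
/- Let Λ, λ be dominant regular integral weights for gl(m|n), each with degree of atypicality r, such that λ ≼ Λ, and let s, t ∈ {1,…,r} satisfy λ^ρ_{n̄'_s} ≤ Λ^ρ_{n̄_t}. Then the number of integers k with λ^ρ_{n̄'_s} + 1 ≤ k ≤ Λ^ρ_{n̄_t} that do not occur as an entry of typ_Λ equals h_t(Λ) − h_s(λ) + t − s. -/
open scoped Classical

noncomputable section

namespace SuZhang

lemma core {N r : ℕ} (f : Fin N → ℤ) (g : Fin r → Fin N) (hf : Function.Injective f)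
    (hg : Function.Injective g) (P : ℤ → Prop) [DecidablePred P] :
    (((Finset.univ.filter fun i : Fin N => ∀ s, g s ≠ i).image f).filter P).card
      + (Finset.univ.filter fun s : Fin r => P (f (g s))).card
      = (Finset.univ.filter fun i : Fin N => P (f i)).card := by
  rw [← Finset.card_image_of_injective (Finset.univ.filter fun s : Fin r => P (f (g s))) hg,
    Finset.filter_image, Finset.card_image_of_injective _ hf, ← Finset.card_union_of_disjoint]
  · congr 1
    ext i
    simp only [Finset.mem_union, Finset.mem_filter, Finset.mem_univ, true_and, Finset.mem_image]
    constructor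
    · rintro (h | ⟨s, h, rfl⟩)
      · exact h.2
      · exact h
    · intro h
      by_cases h' : ∀ s, g s ≠ i
      · exact Or.inl ⟨h', h⟩
      · push Not at h'
        obtain ⟨s, rfl⟩ := h'
        exact Or.inr ⟨s, h, rfl⟩
  · rw [Finset.disjoint_left]
    intro i hi hi'
    simp only [Finset.mem_filter, Finset.mem_univ, true_and, Finset.mem_image] at hi hi'
    obtain ⟨s, _, h⟩ := hi'
    exact hi.1 s h

lemma cntD {N r : ℕ} (f : Fin N → ℤ) (g : Fin r → Fin N) (hf : StrictMono f)
    (hg : StrictMono g) (t : Fin r) :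
    (((Finset.univ.filter fun i : Fin N => ∀ s, g s ≠ i).image f).filter
      (fun k => k ≤ f (g t))).card + (t : ℕ) = (g t : ℕ) := by
  have h := core f g hf.injective hg.injective (fun k => k ≤ f (g t))
  simp only [hf.le_iff_le, hg.le_iff_le] at h
  have e1 : (Finset.univ.filter fun s : Fin r => s ≤ t) = Finset.Iic t := by ext; simp
  have e2 : (Finset.univ.filter fun s : Fin N => s ≤ g t) = Finset.Iic (g t) := by ext; simp
  rw [e1, e2, Fin.card_Iic, Fin.card_Iic] at h
  omega

lemma cntE {N r : ℕ} (f : Fin N → ℤ) (g : Fin r → Fin N) (hf : StrictAnti f)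
    (hg : StrictAnti g) (t : Fin r) :
    (((Finset.univ.filter fun i : Fin N => ∀ s, g s ≠ i).image f).filter
      (fun k => f (g t) < k)).card + (r - 1 - (t : ℕ)) = (g t : ℕ) := by
  have h := core f g hf.injective hg.injective (fun k => f (g t) < k)
  simp only [hf.lt_iff_gt, hg.lt_iff_gt] at h
  have e1 : (Finset.univ.filter fun s : Fin r => t < s) = Finset.Ioi t := by ext; simp
  have e2 : (Finset.univ.filter fun s : Fin N => s < g t) = Finset.Iio (g t) := by ext; simp
  rw [e1, e2, Fin.card_Ioi, Fin.card_Iio] at h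
  exact h

lemma rE_anti {m n : ℕ} {we : Fin m → ℤ} {wd : Fin n → ℤ} (h : Dominant m we wd) :
    StrictAnti (rE m we) := by
  intro i j hij
  have := h.1 i j hij.le
  have h2 : (i : ℕ) < (j : ℕ) := hij
  unfold rE
  omega

lemma rD_mono {m n : ℕ} {we : Fin m → ℤ} {wd : Fin n → ℤ} (h : Dominant m we wd) :
    StrictMono (rD wd) := by
  intro i j hij
  have := h.2 i j hij.le
  have h2 : (i : ℕ) < (j : ℕ) := hij
  unfold rD
  omega

lemma splitLe (S : Finset ℤ) (a b : ℤ) (hab : a ≤ b) :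
    (S.filter (fun k => k ≤ b)).card = (S.filter (fun k => k ≤ a)).card
      + (S.filter (fun k => a < k ∧ k ≤ b)).card := by
  rw [← Finset.card_union_of_disjoint]
  · congr 1
    ext k
    simp only [Finset.mem_union, Finset.mem_filter]
    grind
  · rw [Finset.disjoint_left]
    intro k h1 h2
    simp only [Finset.mem_filter] at h1 h2
    omega

lemma splitGt (S : Finset ℤ) (a b : ℤ) (hab : a ≤ b) :
    (S.filter (fun k => a < k)).card = (S.filter (fun k => b < k)).card
      + (S.filter (fun k => a < k ∧ k ≤ b)).card := by
  rw [← Finset.card_union_of_disjoint]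
  · congr 1
    ext k
    simp only [Finset.mem_union, Finset.mem_filter]
    grind
  · rw [Finset.disjoint_left]
    intro k h1 h2
    simp only [Finset.mem_filter] at h1 h2
    omega

/-- Proposition 3.5: for `λ ≼ Λ` and `λ^ρ_{n̄'_s} ≤ Λ^ρ_{n̄_t}`, the number of
integers in `(λ^ρ_{n̄'_s}, Λ^ρ_{n̄_t}]` that are not entries of `typ_Λ` equals
`h_t(Λ) - h_s(λ) + t - s`. -/
theorem statement1 (m n r : ℕ) (hm : 1 ≤ m) (hn : 1 ≤ n)
    (Le : Fin m → ℤ) (Ld : Fin n → ℤ) (le : Fin m → ℤ) (ld : Fin n → ℤ)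
    (hLdom : Dominant m Le Ld) (hLreg : Regular m Le Ld)
    (hldom : Dominant m le ld) (hlreg : Regular m le ld)
    (mI : Fin r → Fin m) (nI : Fin r → Fin n) (hLEnum : Enum m n r Le Ld mI nI)
    (mI' : Fin r → Fin m) (nI' : Fin r → Fin n) (hlEnum : Enum m n r le ld mI' nI')
    (hprec : Prec m n r le ld mI' nI' Le Ld mI nI)
    (s t : Fin r) (hle : rD ld (nI' s) ≤ rD Ld (nI t)) :
    ((countNotIn (rD ld (nI' s) + 1) (rD Ld (nI t)) (IsTypEntry m Le Ld mI nI) : ℕ) : ℤ)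
      = height Le mI nI t - height le mI' nI' s + ((t : ℕ) : ℤ) - ((s : ℕ) : ℤ) := by
  have hE : ((Finset.univ.filter fun i : Fin m => ∀ s, mI s ≠ i).image (rE m Le))
      = ((Finset.univ.filter fun i : Fin m => ∀ s, mI' s ≠ i).image (rE m le)) := by
    ext k
    simpa using hprec.1.1 k
  have hD : ((Finset.univ.filter fun i : Fin n => ∀ s, nI s ≠ i).image (rD Ld))
      = ((Finset.univ.filter fun i : Fin n => ∀ s, nI' s ≠ i).image (rD ld)) := by
    ext k
    simpa using hprec.1.2 k
  have c1 := cntD (rD Ld) nI (rD_mono hLdom) (fun a b h => hLEnum.nMono a b h) t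
  have c2 := cntD (rD ld) nI' (rD_mono hldom) (fun a b h => hlEnum.nMono a b h) s
  have c3 := cntE (rE m Le) mI (rE_anti hLdom) (fun a b h => hLEnum.mAnti a b h) t
  have c4 := cntE (rE m le) mI' (rE_anti hldom) (fun a b h => hlEnum.mAnti a b h) s
  rw [← hD] at c2
  rw [← hE] at c4
  have hat := hLEnum.atyp t
  have hat' := hlEnum.atyp s
  rw [hat] at c3
  rw [hat'] at c4
  have hb : Le (mI t) = rD Ld (nI t) - m + (mI t : ℕ) := by
    rw [← hat]; unfold rE; ring
  have ha : le (mI' s) = rD ld (nI' s) - m + (mI' s : ℕ) := by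
    rw [← hat']; unfold rE; ring
  unfold height countNotIn
  rw [hb, ha]
  have hmem : ∀ k, IsTypEntry m Le Ld mI nI k ↔
      k ∈ ((Finset.univ.filter fun i : Fin m => ∀ s, mI s ≠ i).image (rE m Le)) ∨
      k ∈ ((Finset.univ.filter fun i : Fin n => ∀ s, nI s ≠ i).image (rD Ld)) := by
    intro k
    simp [IsTypEntry]
  have hdisj : Disjoint ((Finset.univ.filter fun i : Fin m => ∀ s, mI s ≠ i).image (rE m Le))
      ((Finset.univ.filter fun i : Fin n => ∀ s, nI s ≠ i).image (rD Ld)) := by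
    rw [Finset.disjoint_left]
    intro k h1 h2
    simp only [Finset.mem_filter, Finset.mem_univ, true_and, Finset.mem_image] at h1 h2
    obtain ⟨i, hi, rfl⟩ := h1
    obtain ⟨j, hj, h⟩ := h2
    obtain ⟨u, hu, _⟩ := hLEnum.complete i j h.symm
    exact hi u hu
  generalize ((Finset.univ.filter fun i : Fin m => ∀ s, mI s ≠ i).image (rE m Le)) = A at *
  generalize ((Finset.univ.filter fun i : Fin n => ∀ s, nI s ≠ i).image (rD Ld)) = B at *
  generalize rD ld (nI' s) = a at *
  generalize rD Ld (nI t) = b at *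
  have d1 := splitGt A a b hle
  have d2 := splitLe B a b hle
  have key : ((Finset.Icc (a + 1) b).filter fun k => ¬ IsTypEntry m Le Ld mI nI k).card
      + ((A.filter (fun k => a < k ∧ k ≤ b)).card + (B.filter (fun k => a < k ∧ k ≤ b)).card)
      = (Finset.Icc (a + 1) b).card := by
    rw [← Finset.card_union_of_disjoint (Finset.disjoint_filter_filter hdisj),
      ← Finset.card_filter_add_card_filter_not (s := Finset.Icc (a + 1) b)
        (fun k => IsTypEntry m Le Ld mI nI k), add_comm]
    congr 2
    ext k
    simp only [Finset.mem_union, Finset.mem_filter, Finset.mem_Icc, hmem]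
    grind
  rw [Int.card_Icc] at key
  have := s.isLt
  have := t.isLt
  omega
end SuZhang
end
end

section
/- Let Λ ∈ P^Lex_r. Then, as an identity of polynomials in ℤ[q], (Σ_{σ ∈ S^Λ} q^{ℓ(σ)}) · Π_{s=1}^r (q^{max^Λ_s − s + 1} − 1) = Π_{s=1}^r (q^s − 1). -/
open scoped Classical

noncomputable section

namespace SuZhang

section Aux
open Finset Polynomial

def CC {r : ℕ} (M : Fin r → Fin r) (k : ℕ) (τ : Equiv.Perm (Fin r)) : Prop :=
  ∀ s t : Fin r, k ≤ (s : ℕ) → s < t → t ≤ M s → τ s < τ t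

def PP {r : ℕ} (M : Fin r → Fin r) (k : ℕ) : Polynomial ℤ :=
  ∑ τ ∈ univ.filter (fun τ : Equiv.Perm (Fin r) => CC M k τ), (X : Polynomial ℤ) ^ invCount τ

def Adj {r : ℕ} (k m : Fin r) (τ : Equiv.Perm (Fin r)) (p : Fin r) : Prop :=
  k < p ∧ p ≤ m ∧ τ k < τ p ∧ ∀ x, k ≤ x → x ≤ m → ¬ (τ k < τ x ∧ τ x < τ p)

def rk {r : ℕ} (k m : Fin r) (τ : Equiv.Perm (Fin r)) : ℕ :=
  (univ.filter fun x : Fin r => k < x ∧ x ≤ m ∧ τ x < τ k).card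

lemma swap_val {r : ℕ} (τ : Equiv.Perm (Fin r)) (k p x : Fin r) :
    (τ * Equiv.swap k p) x = if x = k then τ p else if x = p then τ k else τ x := by
  rw [Equiv.Perm.mul_apply, Equiv.swap_apply_def]
  split_ifs <;> rfl

lemma adj_inv {r : ℕ} {k m : Fin r} {τ : Equiv.Perm (Fin r)} {p : Fin r} (h : Adj k m τ p) :
    invCount (τ * Equiv.swap k p) = invCount τ + 1 := by
  obtain ⟨h1, h2, h3, h4⟩ := h
  have hinj : ∀ a b, τ a = τ b → a = b := fun a b h => τ.injective h
  unfold invCount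
  have hnot : (k, p) ∉ univ.filter fun q : Fin r × Fin r => q.1 < q.2 ∧ τ q.2 < τ q.1 := by
    simp; intro _; exact h3.le
  rw [← Finset.card_insert_of_notMem hnot]
  let B : Fin r → Prop := fun x => k ≤ x ∧ x ≤ m
  let sw := Equiv.swap k p
  have hsw : ∀ x, sw x = if x = k then p else if x = p then k else x :=
    fun x => Equiv.swap_apply_def k p x
  have hB : ∀ x, B (sw x) ↔ B x := by
    intro x; simp only [B, hsw]; split_ifs <;> grind
  have hss : ∀ x, sw (sw x) = x := fun x => Equiv.swap_swap k p |> fun _ => by simp [sw]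
  let φ : Fin r × Fin r → Fin r × Fin r :=
    fun q => if B q.1 ∧ B q.2 then q else (sw q.1, sw q.2)
  have hφ : ∀ q, φ (φ q) = q := by
    intro q; simp only [φ]
    by_cases hq : B q.1 ∧ B q.2
    · simp [hq]
    · simp [hq, hB, hss]
  have key : ∀ q : Fin r × Fin r, (q.1 < q.2 ∧ (τ * sw) q.2 < (τ * sw) q.1) ↔
      φ q ∈ insert (k, p) (univ.filter fun q : Fin r × Fin r => q.1 < q.2 ∧ τ q.2 < τ q.1) := by
    rintro ⟨a, b⟩
    simp only [φ, mem_insert, mem_filter, mem_univ, true_and]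
    by_cases hq : B a ∧ B b
    · rw [if_pos hq]
      rw [swap_val, swap_val]
      simp only [Prod.mk.injEq]
      obtain ⟨⟨a1, a2⟩, b1, b2⟩ := hq
      have ha := h4 a a1 a2
      have hb := h4 b b1 b2
      have e1 := hinj a k
      have e2 := hinj a p
      have e3 := hinj b k
      have e4 := hinj b p
      split_ifs <;> grind
    · rw [if_neg hq]
      simp only [Equiv.Perm.mul_apply, Prod.mk.injEq]
      have h5 : ¬ (sw a = k ∧ sw b = p) := by
        rintro ⟨ea, eb⟩
        apply hq
        rw [← hB a, ← hB b, ea, eb]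
        exact ⟨⟨le_refl _, h1.le.trans h2⟩, h1.le, h2⟩
      have h6 : a < b ↔ sw a < sw b := by
        simp only [B] at hq
        rw [hsw, hsw]; split_ifs <;> grind
      rw [h6]; simp [h5]
  apply Finset.card_bij' (fun q _ => φ q) (fun q _ => φ q)
  · intro q hq; exact (key q).1 (mem_filter.1 hq).2
  · intro q hq
    have := (key (φ q)).2 (by rw [hφ]; exact hq)
    exact mem_filter.2 ⟨mem_univ _, this⟩
  · intro q _; exact hφ q
  · intro q _; exact hφ q

lemma adj_rk {r : ℕ} {k m : Fin r} {τ : Equiv.Perm (Fin r)} {p : Fin r} (h : Adj k m τ p) :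
    rk k m (τ * Equiv.swap k p) = rk k m τ + 1 := by
  obtain ⟨h1, h2, h3, h4⟩ := h
  unfold rk
  have hnot : p ∉ univ.filter fun x : Fin r => k < x ∧ x ≤ m ∧ τ x < τ k := by
    simp; intro _ _; exact h3.le
  rw [← Finset.card_insert_of_notMem hnot]
  congr 1
  ext x
  have e2 := fun h => τ.injective (a₁ := x) (a₂ := p) h
  have e1 := fun h => τ.injective (a₁ := x) (a₂ := k) h
  have := h4 x
  simp only [mem_insert, mem_filter, mem_univ, true_and, swap_val]
  split_ifs <;> grind

lemma adj_CC {r : ℕ} {M : Fin r → Fin r} (hM : ∀ s t, s ≤ t → t ≤ M s → M t ≤ M s)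
    {k : Fin r} {τ : Equiv.Perm (Fin r)} {p : Fin r} (h : Adj k (M k) τ p) :
    CC M (k + 1) (τ * Equiv.swap k p) ↔ CC M (k + 1) τ := by
  obtain ⟨h1, h2, h3, h4⟩ := h
  unfold CC
  refine forall_congr' fun s => forall_congr' fun t => imp_congr_right fun hs =>
    imp_congr_right fun hst => imp_congr_right fun ht => ?_
  have e1 := fun h => τ.injective (a₁ := s) (a₂ := k) h
  have e2 := fun h => τ.injective (a₁ := s) (a₂ := p) h
  have e3 := fun h => τ.injective (a₁ := t) (a₂ := k) h
  have e4 := fun h => τ.injective (a₁ := t) (a₂ := p) h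
  have hks : k < s := by rw [Fin.lt_def]; omega
  have := h4 s
  have := h4 t
  have := hM k s
  simp only [swap_val]
  split_ifs <;> grind

lemma adj_unique {r : ℕ} {k m : Fin r} {τ : Equiv.Perm (Fin r)} {p p' : Fin r}
    (h : Adj k m τ p) (h' : Adj k m τ p') : p = p' := by
  obtain ⟨h1, h2, h3, h4⟩ := h
  obtain ⟨h1', h2', h3', h4'⟩ := h'
  apply τ.injective
  have := h4 p'
  have := h4' p
  grind

/-- reverse adjacency -/
def Adj' {r : ℕ} (k m : Fin r) (τ : Equiv.Perm (Fin r)) (p : Fin r) : Prop :=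
  k < p ∧ p ≤ m ∧ τ p < τ k ∧ ∀ x, k ≤ x → x ≤ m → ¬ (τ p < τ x ∧ τ x < τ k)

lemma adj'_unique {r : ℕ} {k m : Fin r} {τ : Equiv.Perm (Fin r)} {p p' : Fin r}
    (h : Adj' k m τ p) (h' : Adj' k m τ p') : p = p' := by
  obtain ⟨h1, h2, h3, h4⟩ := h
  obtain ⟨h1', h2', h3', h4'⟩ := h'
  apply τ.injective
  have := h4 p'
  have := h4' p
  grind

lemma adj_swap {r : ℕ} {k m : Fin r} {τ : Equiv.Perm (Fin r)} {p : Fin r} :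
    Adj' k m (τ * Equiv.swap k p) p ↔ Adj k m τ p := by
  unfold Adj Adj'
  refine and_congr_right fun h1 => and_congr_right fun h2 => ?_
  have e : p ≠ k := h1.ne'
  simp only [swap_val, if_true, if_neg e]
  refine and_congr_right fun h3 => forall_congr' fun x => imp_congr_right fun h4 =>
    imp_congr_right fun h5 => ?_
  split_ifs <;> grind

lemma exists_adj {r : ℕ} {k m : Fin r} (τ : Equiv.Perm (Fin r))
    (h : ∃ x, k < x ∧ x ≤ m ∧ τ k < τ x) : ∃ p, Adj k m τ p := by
  obtain ⟨p, hp, hmin⟩ := Finset.exists_min_image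
    (univ.filter fun x : Fin r => k < x ∧ x ≤ m ∧ τ k < τ x) τ (by
      obtain ⟨x, hx⟩ := h; exact ⟨x, by simpa using hx⟩)
  simp only [mem_filter, mem_univ, true_and] at hp hmin
  refine ⟨p, hp.1, hp.2.1, hp.2.2, fun x hx hx' hh => ?_⟩
  have := hmin x
  grind

lemma exists_adj' {r : ℕ} {k m : Fin r} (τ : Equiv.Perm (Fin r))
    (h : ∃ x, k < x ∧ x ≤ m ∧ τ x < τ k) : ∃ p, Adj' k m τ p := by
  obtain ⟨p, hp, hmin⟩ := Finset.exists_max_image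
    (univ.filter fun x : Fin r => k < x ∧ x ≤ m ∧ τ x < τ k) τ (by
      obtain ⟨x, hx⟩ := h; exact ⟨x, by simpa using hx⟩)
  simp only [mem_filter, mem_univ, true_and] at hp hmin
  refine ⟨p, hp.1, hp.2.1, hp.2.2, fun x hx hx' hh => ?_⟩
  have := hmin x
  grind

lemma rk_le {r : ℕ} (k m : Fin r) (τ : Equiv.Perm (Fin r)) : rk k m τ ≤ (m : ℕ) - k := by
  rw [← Fin.card_Ioc]
  apply Finset.card_le_card
  intro x; simp; tauto

def FF {r : ℕ} (M : Fin r → Fin r) (k : Fin r) (i : ℕ) : Polynomial ℤ :=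
  ∑ τ ∈ univ.filter (fun τ : Equiv.Perm (Fin r) => CC M (k + 1) τ ∧ rk k (M k) τ = i),
    (X : Polynomial ℤ) ^ invCount τ

lemma FF_succ {r : ℕ} {M : Fin r → Fin r} (hM : ∀ s t, s ≤ t → t ≤ M s → M t ≤ M s)
    (k : Fin r) (i : ℕ) (hi : i < (M k : ℕ) - k) : FF M k (i + 1) = X * FF M k i := by
  have hex : ∀ τ : Equiv.Perm (Fin r), rk k (M k) τ = i → ∃ p, Adj k (M k) τ p := by
    intro τ hτ
    apply exists_adj
    by_contra hcon
    push Not at hcon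
    have : (Ioc k (M k)).card ≤ rk k (M k) τ := by
      apply Finset.card_le_card
      intro x hx
      simp at hx
      have := hcon x hx.1 hx.2
      have e := fun h => τ.injective (a₁ := x) (a₂ := k) h
      simp
      grind
    rw [Fin.card_Ioc] at this
    omega
  unfold FF
  rw [Finset.mul_sum]
  symm
  refine Finset.sum_bij (fun τ hτ => τ * Equiv.swap k (hex τ (by simpa using (mem_filter.1 hτ).2.2)).choose) ?_ ?_ ?_ ?_
  · intro τ hτ
    have hh := (hex τ (by simpa using (mem_filter.1 hτ).2.2)).choose_spec
    simp only [mem_filter, mem_univ, true_and] at hτ ⊢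
    exact ⟨(adj_CC hM hh).2 hτ.1, by rw [adj_rk hh, hτ.2]⟩
  · intro τ hτ τ' hτ' heq
    have hh := (hex τ (by simpa using (mem_filter.1 hτ).2.2)).choose_spec
    have hh' := (hex τ' (by simpa using (mem_filter.1 hτ').2.2)).choose_spec
    rw [← adj_swap] at hh hh'
    change τ * _ = τ' * _ at heq
    rw [heq] at hh
    have e := adj'_unique hh hh'
    rw [e] at heq
    exact mul_right_cancel heq
  · intro τ hτ
    simp only [mem_filter, mem_univ, true_and] at hτ
    obtain ⟨p, hp⟩ : ∃ p, Adj' k (M k) τ p := by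
      apply exists_adj'
      have : 0 < rk k (M k) τ := by omega
      obtain ⟨x, hx⟩ := Finset.card_pos.1 this
      exact ⟨x, by simpa using hx⟩
    have e : τ * Equiv.swap k p * Equiv.swap k p = τ := by
      rw [mul_assoc, Equiv.swap_mul_self, mul_one]
    have hp2 : Adj k (M k) (τ * Equiv.swap k p) p := by
      rw [← adj_swap, e]; exact hp
    have hm : CC M (k + 1) (τ * Equiv.swap k p) ∧ rk k (M k) (τ * Equiv.swap k p) = i := by
      constructor
      · rw [← adj_CC hM hp2, e]; exact hτ.1
      · have := adj_rk hp2
        rw [e] at this; omega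
    refine ⟨τ * Equiv.swap k p, by simpa using hm, ?_⟩
    have := adj_unique (hex _ hm.2).choose_spec hp2
    simp only [this, e]
  · intro τ hτ
    have hh := (hex τ (by simpa using (mem_filter.1 hτ).2.2)).choose_spec
    rw [adj_inv hh, pow_succ, mul_comm]

lemma PP_step {r : ℕ} {M : Fin r → Fin r} (hM : ∀ s t, s ≤ t → t ≤ M s → M t ≤ M s)
    (k : Fin r) :
    PP M k * (X ^ ((M k : ℕ) - k + 1) - 1) = PP M (k + 1) * (X - 1) := by
  have h0 : PP M k = FF M k 0 := by
    unfold PP FF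
    congr 1
    ext τ
    rw [mem_filter, mem_filter, rk, card_eq_zero, filter_eq_empty_iff]
    simp only [mem_univ, true_and, true_implies]
    unfold CC
    constructor
    · intro h
      refine ⟨fun s t hs => h s t (by omega), fun {x} ⟨h1, h2, h3⟩ => ?_⟩
      exact absurd (h k x le_rfl h1 h2) h3.asymm
    · rintro ⟨h1, h2⟩ s t hs hst ht
      rcases hs.eq_or_lt with e | e
      · have e' : k = s := Fin.ext e
        subst e'
        have h3 := @h2 t
        have e2 := fun h => τ.injective (a₁ := k) (a₂ := t) h
        grind
      · exact h1 s t e hst ht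
  have hF : ∀ i, i ≤ (M k : ℕ) - k → FF M k i = X ^ i * FF M k 0 := by
    intro i
    induction i with
    | zero => simp
    | succ i ih =>
      intro hi
      rw [FF_succ hM k i (by omega), ih (by omega), pow_succ]; ring
  have h1 : PP M (k + 1) = ∑ i ∈ range ((M k : ℕ) - k + 1), FF M k i := by
    unfold PP FF
    rw [← Finset.sum_fiberwise_of_maps_to (s := univ.filter (fun τ : Equiv.Perm (Fin r) => CC M (k + 1) τ)) (t := range ((M k : ℕ) - k + 1)) (g := rk k (M k))]
    · simp only [Finset.filter_filter]
    · intro τ _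
      have := rk_le k (M k) τ
      simp; omega
  rw [h1, Finset.sum_congr rfl (fun i hi => hF i (by simp at hi; omega)), ← Finset.sum_mul, h0,
    mul_right_comm, geom_sum_mul, mul_comm]

lemma PP_all {r : ℕ} {M : Fin r → Fin r} (hM : ∀ s t, s ≤ t → t ≤ M s → M t ≤ M s) :
    PP M 0 * ∏ s : Fin r, ((X : Polynomial ℤ) ^ ((M s : ℕ) - s + 1) - 1)
      = PP M r * (X - 1) ^ r := by
  have h : ∀ k, k ≤ r → PP M 0 * ∏ s ∈ univ.filter (fun s : Fin r => (s : ℕ) < k),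
      ((X : Polynomial ℤ) ^ ((M s : ℕ) - s + 1) - 1) = PP M k * (X - 1) ^ k := by
    intro k
    induction k with
    | zero => simp
    | succ k ih =>
      intro hk
      have : univ.filter (fun s : Fin r => (s : ℕ) < k + 1)
          = insert ⟨k, hk⟩ (univ.filter (fun s : Fin r => (s : ℕ) < k)) := by
        ext x; simp [Fin.ext_iff]; omega
      rw [this, Finset.prod_insert (by simp), mul_left_comm, ih (by omega)]
      have h2 := PP_step hM ⟨k, hk⟩
      simp only at h2
      rw [← mul_assoc, mul_comm _ (PP M k), h2, pow_succ]; ring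
  have := h r le_rfl
  rwa [Finset.filter_true_of_mem (fun s _ => s.isLt)] at this

lemma PP_top {r : ℕ} (M M' : Fin r → Fin r) : PP M r = PP M' r := by
  unfold PP
  congr 1
  ext τ
  simp only [mem_filter, mem_univ, true_and]
  unfold CC
  constructor <;> intro _ s t hs <;> have := s.isLt <;> omega

lemma mahon (r : ℕ) (M : Fin r → Fin r) : PP M r * (X - 1) ^ r
    = ∏ s : Fin r, ((X : Polynomial ℤ) ^ ((s : ℕ) + 1) - 1) := by
  let M' : Fin r → Fin r := fun s => ⟨r - 1, by have := s.isLt; omega⟩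
  rw [PP_top M M', ← PP_all (M := M') (fun s t _ _ => le_refl _)]
  have h1 : PP M' 0 = 1 := by
    unfold PP
    have : univ.filter (fun τ : Equiv.Perm (Fin r) => CC M' 0 τ) = {1} := by
      ext τ
      simp only [mem_filter, mem_univ, true_and, mem_singleton]
      constructor
      · intro h
        have hm : StrictMono τ := fun s t hst => h s t (Nat.zero_le _) hst (by
          rw [Fin.le_def]; have := t.isLt; simp only [M']; omega)
        ext x
        have := (hm.range_inj (strictMono_id (α := Fin r))).1 (by simp)
        rw [this]; rfl
      · rintro rfl s t _ h _
        exact h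
    rw [this, Finset.sum_singleton]
    have : invCount (1 : Equiv.Perm (Fin r)) = 0 := by
      unfold invCount
      rw [card_eq_zero, filter_eq_empty_iff]
      rintro ⟨a, b⟩ _ ⟨h1, h2⟩
      exact h1.asymm h2
    rw [this, pow_zero]
  rw [h1, one_mul, ← Equiv.prod_comp Fin.revPerm]
  refine Finset.prod_congr rfl fun s _ => ?_
  have := s.isLt
  have e : ((M' (Fin.revPerm s) : Fin r) : ℕ) - (Fin.revPerm s : Fin r) + 1 = s + 1 := by
    simp only [M', Fin.revPerm_apply, Fin.val_rev]; omega
  rw [e]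

lemma invCount_inv {r : ℕ} (σ : Equiv.Perm (Fin r)) : invCount σ⁻¹ = invCount σ := by
  unfold invCount
  apply Finset.card_bij' (fun q _ => (σ⁻¹ q.2, σ⁻¹ q.1)) (fun q _ => (σ q.2, σ q.1))
  · rintro ⟨a, b⟩ h; simp at h ⊢; tauto
  · rintro ⟨a, b⟩ h; simp at h ⊢; tauto
  · rintro ⟨a, b⟩ h; simp
  · rintro ⟨a, b⟩ h; simp

end Aux

/-- Proposition 3.18, formula (3.30): for `Λ ∈ P^Lex_r`,
`S^Λ(q) · Π_{s=1}^r (q^{max^Λ_s - s + 1} - 1) = Π_{s=1}^r (q^s - 1)`. -/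
theorem statement4 (m n r : ℕ) (hm : 1 ≤ m) (hn : 1 ≤ n)
    (we : Fin m → ℤ) (wd : Fin n → ℤ) (hreg : Regular m we wd)
    (mI : Fin r → Fin m) (nI : Fin r → Fin n) (hEnum : Enum m n r we wd mI nI)
    (hlex : Lexical wd nI) (hsort : TypSorted m n r we wd mI nI)
    (maxS : Fin r → Fin r)
    (hmax : ∀ s : Fin r, s ≤ maxS s ∧ dRel we mI nI s (maxS s) ∧
      ∀ p : Fin r, s ≤ p → dRel we mI nI s p → p ≤ maxS s) :
    (∑ σ ∈ Finset.univ.filter (fun σ : Equiv.Perm (Fin r) => σ ∈ SLam we mI nI),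
        (Polynomial.X : Polynomial ℤ) ^ invCount σ)
      * ∏ s : Fin r, ((Polynomial.X : Polynomial ℤ) ^ ((maxS s : ℕ) - (s : ℕ) + 1) - 1)
    = ∏ s : Fin r, ((Polynomial.X : Polynomial ℤ) ^ ((s : ℕ) + 1) - 1) := by
  have hd : ∀ s t : Fin r, s ≤ t → (dRel we mI nI s t ↔ t ≤ maxS s) := by
    intro s t hst
    refine ⟨fun h => (hmax s).2.2 t hst h, fun h p hp hp' => (hmax s).2.1 p hp (hp'.trans h)⟩
  have hM : ∀ s t, s ≤ t → t ≤ maxS s → maxS t ≤ maxS s := by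
    intro s t hst ht
    refine (hmax s).2.2 _ (hst.trans (hmax t).1) ?_
    intro p hp hp'
    rcases le_total p t with h | h
    · exact (hmax s).2.1 p hp (h.trans ht)
    · have h1 := (hmax s).2.1 t hst ht
      have h2 := (hmax t).2.1 p h hp'
      unfold cRel at *
      rcases h1 with rfl | h1
      · exact h2
      · rcases h2 with rfl | h2
        · exact Or.inr h1
        · exact Or.inr (by omega)
  rw [← mahon r maxS, ← PP_all hM]
  congr 1
  unfold PP
  refine Finset.sum_nbij' (fun σ => σ⁻¹) (fun σ => σ⁻¹) ?_ ?_ ?_ ?_ ?_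
  · intro σ hσ
    rw [Finset.mem_filter] at hσ ⊢
    refine ⟨Finset.mem_univ _, ?_⟩
    replace hσ := hσ.2
    exact fun s t _ hst ht => hσ s t hst ((hd s t hst.le).2 ht)
  · intro σ hσ
    rw [Finset.mem_filter] at hσ ⊢
    refine ⟨Finset.mem_univ _, ?_⟩
    replace hσ := hσ.2
    change ∀ s t : Fin r, s < t → dRel we mI nI s t → (σ⁻¹)⁻¹ s < (σ⁻¹)⁻¹ t
    rw [inv_inv]
    exact fun s t hst ht => hσ s t (Nat.zero_le _) hst ((hd s t hst.le).1 ht)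
  · intro σ _; simp
  · intro σ _; simp
  · intro σ _; rw [invCount_inv]
end SuZhang
end
end

section
/- Let Λ, λ ∈ P^Lex_r with λ ≼ Λ, and for s ∈ {1,…,r} set i_s = min{ i ∈ {1,…,r} : λ^ρ_{n̄'_s} ≤ Λ^ρ_{n̄_i} }. Then Σ_{σ ∈ S̃^{Λ,λ}} q^{ℓ(σ)} = Π_{s=1}^r (1 + q + ⋯ + q^{s − i_s}) as polynomials in q. -/
open scoped Classical

noncomputable section

namespace SuZhang

/-- Build a permutation from the image of the last point and the standardised rest. -/
def insPerm {N : ℕ} (p : Fin (N + 1) × Equiv.Perm (Fin N)) : Equiv.Perm (Fin (N + 1)) :=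
  ((finSuccEquiv' (Fin.last N)).trans (Equiv.optionCongr p.2)).trans (finSuccEquiv' p.1).symm

theorem insPerm_last {N : ℕ} (p : Fin (N + 1) × Equiv.Perm (Fin N)) :
    insPerm p (Fin.last N) = p.1 := by
  simp [insPerm, finSuccEquiv'_at]

theorem insPerm_castSucc {N : ℕ} (p : Fin (N + 1) × Equiv.Perm (Fin N)) (s : Fin N) :
    insPerm p s.castSucc = p.1.succAbove (p.2 s) := by
  have : finSuccEquiv' (Fin.last N) s.castSucc = some s := by
    rw [← Fin.succAbove_last_apply, finSuccEquiv'_succAbove]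
  simp [insPerm, this]

theorem insPerm_bij (N : ℕ) : Function.Bijective (insPerm (N := N)) := by
  rw [Fintype.bijective_iff_injective_and_card]
  constructor
  · rintro ⟨k, τ⟩ ⟨k', τ'⟩ h
    have h1 : k = k' := by
      have := congrArg (fun e => e (Fin.last N)) h
      simpa [insPerm_last] using this
    subst h1
    have h2 : τ = τ' := by
      ext1 s
      have := congrArg (fun e => e s.castSucc) h
      simpa [insPerm_castSucc] using this
    rw [h2]
  · simp [Fintype.card_perm, Nat.factorial_succ]

theorem sum_ge (N k : ℕ) : ∑ i ∈ Finset.range N, (if k ≤ i then 1 else 0) = N - k := by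
  induction N with
  | zero => simp
  | succ N ih => rw [Finset.sum_range_succ, ih]; split_ifs <;> omega

theorem invCount_eq {r : ℕ} (σ : Equiv.Perm (Fin r)) :
    invCount σ = ∑ i, ∑ j, if i < j ∧ σ j < σ i then 1 else 0 := by
  rw [invCount, Finset.card_filter, Fintype.sum_prod_type]

theorem invCount_ins {N : ℕ} (k : Fin (N + 1)) (τ : Equiv.Perm (Fin N)) :
    invCount (insPerm (k, τ)) = invCount τ + (N - (k : ℕ)) := by
  rw [invCount_eq, invCount_eq, Fin.sum_univ_castSucc]
  have h0 : ∀ j, ¬ (Fin.last N < j) := fun j => not_lt.2 (Fin.le_last j)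
  simp only [Fin.sum_univ_castSucc, insPerm_last, insPerm_castSucc, h0, false_and, if_false,
    Finset.sum_const_zero, add_zero, Fin.castSucc_lt_castSucc_iff, Fin.castSucc_lt_last, true_and,
    Finset.sum_add_distrib, Fin.succAbove_lt_succAbove_iff]
  congr 1
  rw [Equiv.sum_comp τ (fun i => if k < k.succAbove i then 1 else 0)]
  rw [← sum_ge N k, ← Fin.sum_univ_eq_sum_range (fun i => if (k : ℕ) ≤ i then 1 else 0)]
  refine Finset.sum_congr rfl fun i _ => ?_
  simp only [Fin.lt_succAbove_iff_le_castSucc, Fin.le_def, Fin.val_castSucc]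

theorem sum_q (N b : ℕ) (hb : b ≤ N) :
    ∑ k : Fin (N + 1), (if b ≤ (k : ℕ) then (Polynomial.X : Polynomial ℤ) ^ (N - (k : ℕ)) else 0)
      = ∑ j ∈ Finset.range (N - b + 1), (Polynomial.X : Polynomial ℤ) ^ j := by
  rw [Fin.sum_univ_eq_sum_range
    (fun k => if b ≤ k then (Polynomial.X : Polynomial ℤ) ^ (N - k) else 0),
    ← Finset.sum_range_reflect, ← Finset.sum_filter_add_sum_filter_not _ (fun j => j < N - b + 1)]
  rw [Finset.sum_eq_zero (s := Finset.filter (fun j => ¬ j < N - b + 1) _), add_zero]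
  · refine Finset.sum_congr ?_ ?_
    · ext j; simp; omega
    · intro j hj
      simp at hj
      rw [if_pos (by omega)]
      congr 1; omega
  · intro j hj
    simp at hj
    rw [if_neg (by omega)]

theorem key (r : ℕ) (b : Fin r → ℕ) (hb : Monotone b) (hle : ∀ s, b s ≤ (s : ℕ)) :
    ∑ σ : Equiv.Perm (Fin r), (if ∀ s, b s ≤ (σ s : ℕ) then
        (Polynomial.X : Polynomial ℤ) ^ invCount σ else 0)
      = ∏ s : Fin r, ∑ j ∈ Finset.range ((s : ℕ) - b s + 1), (Polynomial.X : Polynomial ℤ) ^ j := by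
  induction r with
  | zero => simp [invCount]
  | succ N ih =>
    rw [← (insPerm_bij N).sum_comp, Fintype.sum_prod_type, Fin.prod_univ_castSucc]
    have ih' := ih (fun s => b s.castSucc) (fun s t h => hb (by simpa using h))
      (fun s => by simpa using hle s.castSucc)
    simp only [Fin.val_castSucc, Fin.val_last]
    rw [← ih', ← sum_q N _ (by simpa using hle (Fin.last N)), mul_comm, Finset.sum_mul_sum]
    refine Finset.sum_congr rfl fun k _ => Finset.sum_congr rfl fun τ _ => ?_
    have hiff : (∀ s, b s ≤ (insPerm (k, τ) s : ℕ)) ↔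
        (b (Fin.last N) ≤ (k : ℕ) ∧ ∀ s : Fin N, b s.castSucc ≤ (τ s : ℕ)) := by
      rw [Fin.forall_fin_succ', and_comm]
      simp only [insPerm_last, insPerm_castSucc]
      refine and_congr_right fun hk => forall_congr' fun s => ?_
      have h1 : b s.castSucc ≤ b (Fin.last N) := hb (Fin.le_last _)
      by_cases h : (τ s).castSucc < k
      · rw [Fin.succAbove_of_castSucc_lt _ _ h, Fin.val_castSucc]
      · rw [Fin.succAbove_of_le_castSucc _ _ (not_lt.1 h), Fin.val_succ]
        have := Fin.le_def.1 (not_lt.1 h)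
        simp at this
        omega
    simp only [hiff, invCount_ins]
    by_cases h1 : b (Fin.last N) ≤ (k : ℕ) <;>
      by_cases h2 : ∀ s : Fin N, b s.castSucc ≤ (τ s : ℕ) <;> simp [h1, h2, pow_add, mul_comm]

/-- Proposition 3.18, formula (3.31): for `Λ, λ ∈ P^Lex_r` with `λ ≼ Λ`,
`S̃^{Λ,λ}(q) = Π_{s=1}^r (1 + q + ⋯ + q^{s - i_s})` where
`i_s = min{i : λ^ρ_{n̄'_s} ≤ Λ^ρ_{n̄_i}}`. -/
theorem statement5 (m n r : ℕ) (hm : 1 ≤ m) (hn : 1 ≤ n)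
    (Le : Fin m → ℤ) (Ld : Fin n → ℤ) (le : Fin m → ℤ) (ld : Fin n → ℤ)
    (hLreg : Regular m Le Ld) (hlreg : Regular m le ld)
    (mI : Fin r → Fin m) (nI : Fin r → Fin n) (hLEnum : Enum m n r Le Ld mI nI)
    (mI' : Fin r → Fin m) (nI' : Fin r → Fin n) (hlEnum : Enum m n r le ld mI' nI')
    (hLlex : Lexical Ld nI) (hLsort : TypSorted m n r Le Ld mI nI)
    (hllex : Lexical ld nI') (hlsort : TypSorted m n r le ld mI' nI')
    (hprec : Prec m n r le ld mI' nI' Le Ld mI nI)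
    (iS : Fin r → Fin r)
    (hiS : ∀ s : Fin r, rD ld (nI' s) ≤ rD Ld (nI (iS s)) ∧
      ∀ i : Fin r, rD ld (nI' s) ≤ rD Ld (nI i) → iS s ≤ i) :
    ∑ σ ∈ Finset.univ.filter
        (fun σ : Equiv.Perm (Fin r) => STildeMem m n r le ld mI' nI' Le Ld mI nI σ),
        (Polynomial.X : Polynomial ℤ) ^ invCount σ
      = ∏ s : Fin r, ∑ j ∈ Finset.range ((s : ℕ) - (iS s : ℕ) + 1),
          (Polynomial.X : Polynomial ℤ) ^ j := by
  have hmono : Monotone fun s => ((iS s : Fin r) : ℕ) := by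
    intro s t hst
    exact (hiS s).2 _ ((hllex hst).trans (hiS t).1)
  have hle : ∀ s, ((iS s : Fin r) : ℕ) ≤ (s : ℕ) := fun s => (hiS s).2 s (hprec.2 s)
  rw [← key r (fun s => (iS s : ℕ)) hmono hle, Finset.sum_filter]
  refine Finset.sum_congr rfl fun σ _ => ?_
  have : STildeMem m n r le ld mI' nI' Le Ld mI nI σ ↔ ∀ s, (iS s : ℕ) ≤ (σ s : ℕ) := by
    constructor
    · intro h s
      exact (hiS s).2 _ (h.2 s)
    · intro h
      exact ⟨hprec.1, fun s => (hiS s).1.trans (hLlex (Fin.le_def.2 (h s)))⟩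
  simp only [this]
end SuZhang
end
end

section
/- Let x ∈ ℤ^r be lexical (i.e. x_1 ≤ … ≤ x_r). For 1 ≤ s ≤ t ≤ r set c^x_{s,t} = 1 if t = s or x_t − x_s < t − s (and 0 otherwise), set d^x_{s,t} = 1 if c^x_{s,p} = 1 for all s ≤ p ≤ t (and 0 otherwise), and set x̂_s = #{p ∈ {1,…,s−1} : d^x_{p,s} = 0}. Then x̂ = (x̂_1,…,x̂_r) is lexical with 0 ≤ x̂_s ≤ s − 1 for every s, and Z_q(x;b) = Z_q(x̂;b) for every b ∈ ℤ^r. -/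
open scoped Classical

noncomputable section

namespace SuZhang

lemma dX_iff {r : ℕ} (x : Fin r → ℤ) (s t : Fin r) :
    dX x s t ↔ ∀ p, s < p → p ≤ t → x p - x s < ((p : ℕ) : ℤ) - ((s : ℕ) : ℤ) := by
  constructor
  · intro h p h1 h2
    rcases h p h1.le h2 with h3 | h3
    · exact absurd h3 h1.ne'
    · exact h3
  · intro h p h1 h2
    rcases h1.eq_or_lt with h3 | h3
    · exact Or.inl h3.symm
    · exact Or.inr (h p h3 h2)

/-- delete entry `i` and shift. -/
def del {N : ℕ} (x : Fin (N + 1) → ℤ) (i : Fin N) : Fin N → ℤ :=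
  fun j => if (j : ℕ) < (i : ℕ) then x j.castSucc else x j.succ - 1

/-- the skipping map -/
def sk {N : ℕ} (i : Fin N) (j : Fin N) : Fin (N + 1) :=
  if (j : ℕ) < (i : ℕ) then j.castSucc else j.succ

lemma sk_val {N : ℕ} (i j : Fin N) :
    ((sk i j : Fin (N + 1)) : ℕ) = if (j : ℕ) < (i : ℕ) then (j : ℕ) else (j : ℕ) + 1 := by
  unfold sk; split_ifs <;> simp

lemma del_eq {N : ℕ} (x : Fin (N + 1) → ℤ) (i j : Fin N) :
    del x i j - ((j : ℕ) : ℤ) = x (sk i j) - (((sk i j : Fin (N + 1)) : ℕ) : ℤ) := by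
  unfold del sk; split_ifs <;> simp; ring

lemma sk_surj {N : ℕ} (i : Fin N) (p : Fin (N + 1)) (hp : p ≠ i.castSucc) :
    ∃ j, sk i j = p := by
  have hp' : (p : ℕ) ≠ (i : ℕ) := fun h => hp (Fin.ext (by simpa using h))
  have := i.isLt
  have := p.isLt
  by_cases h : (p : ℕ) < (i : ℕ)
  · refine ⟨⟨p, by omega⟩, Fin.ext ?_⟩
    rw [sk_val]; simp [h]
  · refine ⟨⟨p - 1, by omega⟩, Fin.ext ?_⟩
    rw [sk_val]
    simp only
    split_ifs <;> omega

lemma dX_del {N : ℕ} (x : Fin (N + 1) → ℤ) (i : Fin N) (hi : x i.castSucc < x i.succ)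
    (s t : Fin N) : dX (del x i) s t ↔ dX x (sk i s) (sk i t) := by
  rw [dX_iff, dX_iff]
  have es := del_eq x i s
  constructor
  · intro h p h1 h2
    by_cases hp : p = i.castSucc
    · subst hp
      have v1 := sk_val i s
      have v2 := sk_val i t
      rw [Fin.lt_def] at h1
      rw [Fin.le_def] at h2
      simp only [Fin.val_castSucc] at h1 h2 ⊢
      have a1 : s < i := by rw [Fin.lt_def]; split_ifs at v1 <;> omega
      have a2 : i ≤ t := by rw [Fin.le_def]; split_ifs at v2 <;> omega
      have := h i a1 a2
      have e := del_eq x i i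
      have e2 : sk i i = i.succ := by simp [sk]
      rw [e2] at e
      simp only [Fin.val_succ] at e
      push_cast at e
      omega
    · obtain ⟨j, rfl⟩ := sk_surj i p hp
      have v1 := sk_val i s
      have v2 := sk_val i t
      have v3 := sk_val i j
      rw [Fin.lt_def] at h1
      rw [Fin.le_def] at h2
      have := h j (by rw [Fin.lt_def]; split_ifs at v1 v3 <;> omega)
        (by rw [Fin.le_def]; split_ifs at v2 v3 <;> omega)
      have e := del_eq x i j
      omega
  · intro h j h1 h2
    have v1 := sk_val i s
    have v2 := sk_val i t
    have v3 := sk_val i j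
    rw [Fin.lt_def] at h1
    rw [Fin.le_def] at h2
    have := h (sk i j) (by rw [Fin.lt_def]; split_ifs at v1 v3 <;> omega)
        (by rw [Fin.le_def]; split_ifs at v2 v3 <;> omega)
    have e := del_eq x i j
    omega

lemma del_mono {N : ℕ} (x : Fin (N + 1) → ℤ) (hx : Monotone x) (i : Fin N)
    (hi : x i.castSucc < x i.succ) : Monotone (del x i) := by
  intro s t hst
  rw [Fin.le_def] at hst
  unfold del
  split_ifs with h1 h2 h2
  · exact hx (Fin.le_def.2 (by simp only [Fin.val_castSucc, Fin.val_succ]; omega))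
  · have a : x s.castSucc ≤ x i.castSucc := hx (Fin.le_def.2 (by simp only [Fin.val_castSucc, Fin.val_succ]; omega))
    have b : x i.succ ≤ x t.succ := hx (Fin.le_def.2 (by simp only [Fin.val_castSucc, Fin.val_succ]; omega))
    omega
  · omega
  · have : x s.succ ≤ x t.succ := hx (Fin.le_def.2 (by simp only [Fin.val_castSucc, Fin.val_succ]; omega))
    omega

lemma dX_castSucc {N : ℕ} (x : Fin (N + 1) → ℤ) (s t : Fin N) :
    dX (fun j => x j.castSucc) s t ↔ dX x s.castSucc t.castSucc := by
  rw [dX_iff, dX_iff]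
  constructor
  · intro h p h1 h2
    have hp : (p : ℕ) < N := lt_of_le_of_lt (by simpa [Fin.le_def] using h2) t.isLt
    exact h ⟨p, hp⟩ (by simpa [Fin.lt_def] using h1) (by simpa [Fin.le_def] using h2)
  · intro h p h1 h2
    exact h p.castSucc (by simpa using h1) (by simpa using h2)

lemma dX_step {N : ℕ} (x : Fin (N + 1) → ℤ) (i : Fin N) :
    dX x i.castSucc i.succ ↔ ¬ x i.castSucc < x i.succ := by
  rw [dX_iff]
  constructor
  · intro h
    have := h i.succ (by simp [Fin.lt_def]) le_rfl
    simp at this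
    omega
  · intro h p h1 h2
    have : p = i.succ := by
      apply Fin.ext
      simp [Fin.lt_def, Fin.le_def] at h1 h2 ⊢
      omega
    subst this
    simp
    omega

lemma Zq_congr (N : ℕ) : ∀ (x y : Fin N → ℤ) (b : Fin N → ℤ), Monotone x → Monotone y →
    (∀ s t, dX x s t ↔ dX y s t) → Zq N x b = Zq N y b := by
  induction N with
  | zero => intros; simp [Zq]
  | succ N ih =>
    intro x y b hx hy hd
    rw [Zq, Zq]
    simp only [hx, hy, true_and]
    split_ifs
    · congr 1
      · apply ih
        · exact fun s t h => hx (by simpa using h)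
        · exact fun s t h => hy (by simpa using h)
        · intro s t
          rw [dX_castSucc, dX_castSucc, hd]
      · apply Finset.sum_congr rfl
        intro i _
        have hc : x i.castSucc < x i.succ ↔ y i.castSucc < y i.succ := by
          rw [← not_iff_not, ← dX_step, ← dX_step, hd]
        by_cases h : x i.castSucc < x i.succ
        · have h' := hc.1 h
          rw [if_pos h, if_pos h']
          congr 1
          refine ih (del x i) (del y i) _ (del_mono x hx i h) (del_mono y hy i h') ?_
          intro s t
          rw [dX_del x i h, dX_del y i h', hd]
        · rw [if_neg h, if_neg (fun h' => h (hc.2 h'))]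
    · rfl

lemma dX_anti {r : ℕ} {x : Fin r → ℤ} {s t u : Fin r} (h : dX x s u) (htu : t ≤ u) :
    dX x s t := fun p h1 h2 => h p h1 (h2.trans htu)

lemma dX_trans {r : ℕ} {x : Fin r → ℤ} {s t u : Fin r} (h : dX x s t) (hst : s ≤ t)
    (h' : dX x t u) : dX x s u := by
  rw [dX_iff] at *
  intro p h1 h2
  rcases le_or_gt p t with h3 | h3
  · exact h p h1 h3
  · have := h' p h3 h2
    rcases hst.eq_or_lt with h4 | h4
    · subst h4; exact this
    · have := h t h4 le_rfl
      omega

/-- the set of `p < s` with `d = 1` -/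
def dn {r : ℕ} (x : Fin r → ℤ) (s : Fin r) : Finset (Fin r) :=
  Finset.univ.filter fun p : Fin r => p < s ∧ dX x p s

lemma mem_dn {r : ℕ} (x : Fin r → ℤ) (s p : Fin r) : p ∈ dn x s ↔ p < s ∧ dX x p s := by
  simp [dn]

lemma xhat_add {r : ℕ} (x : Fin r → ℤ) (s : Fin r) :
    xhat x s + ((dn x s).card : ℤ) = ((s : ℕ) : ℤ) := by
  have h := Finset.card_filter_add_card_filter_not (s := Finset.Iio s) (fun p => dX x p s)
  have e1 : (Finset.Iio s).filter (fun p => dX x p s) = dn x s := by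
    ext p; simp [dn]
  have e2 : (Finset.Iio s).filter (fun p => ¬ dX x p s) =
      Finset.univ.filter fun p : Fin r => p < s ∧ ¬ dX x p s := by
    ext p; simp
  rw [e1, e2, Fin.card_Iio] at h
  unfold xhat
  omega

lemma dX_xhat {r : ℕ} (x : Fin r → ℤ) (s t : Fin r) : dX x s t ↔ dX (xhat x) s t := by
  constructor
  · intro h
    rw [dX_iff]
    intro p h1 h2
    have hsp := dX_anti h h2
    have hlt : (dn x s).card < (dn x p).card := by
      apply Finset.card_lt_card
      rw [Finset.ssubset_iff_of_subset]
      · exact ⟨s, (mem_dn _ _ _).2 ⟨h1, hsp⟩, fun h => absurd ((mem_dn _ _ _).1 h).1 (lt_irrefl _)⟩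
      · intro q hq
        rw [mem_dn] at *
        exact ⟨hq.1.trans h1, dX_trans hq.2 hq.1.le hsp⟩
    have e1 := xhat_add x s
    have e2 := xhat_add x p
    omega
  · intro h
    rw [dX_iff] at h
    rw [dX_iff]
    intro p
    induction p using WellFoundedLT.induction with
    | _ p ih =>
    intro h1 h2
    by_contra hc
    have hle : (dn x p).card ≤ (dn x s).card := by
      apply Finset.card_le_card
      intro q hq
      rw [mem_dn] at *
      obtain ⟨hq1, hq2⟩ := hq
      have hqp := (dX_iff _ _ _).1 hq2 p hq1 le_rfl
      rcases lt_trichotomy q s with h3 | h3 | h3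
      · exact ⟨h3, dX_anti hq2 h1.le⟩
      · subst h3; exact absurd hqp hc
      · have := ih q hq1 h3 (hq1.le.trans h2)
        omega
    have := h p h1 h2
    have e1 := xhat_add x s
    have e2 := xhat_add x p
    omega

lemma xhat_mono {r : ℕ} (x : Fin r → ℤ) : Monotone (xhat x) := by
  intro s t hst
  unfold xhat
  norm_cast
  apply Finset.card_le_card
  intro p hp
  simp only [Finset.mem_filter, Finset.mem_univ, true_and] at *
  exact ⟨hp.1.trans_le hst, fun h => hp.2 (dX_anti h hst)⟩

/-- formula (3.38): for a lexical tuple `x`, the tuple `x̂` with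
`x̂_s = #{p < s : d^x_{p,s} = 0}` is lexical, satisfies `0 ≤ x̂_s ≤ s - 1`, and
`Z_q(x; b) = Z_q(x̂; b)` for every `b`. -/
theorem statement6 (r : ℕ) (hr : 1 ≤ r) (x : Fin r → ℤ) (hlex : Monotone x) :
    Monotone (xhat x) ∧
    (∀ s : Fin r, 0 ≤ xhat x s ∧ xhat x s ≤ ((s : ℕ) : ℤ)) ∧
    (∀ b : Fin r → ℤ, Zq r x b = Zq r (xhat x) b) := by
  refine ⟨xhat_mono x, fun s => ?_, fun b => ?_⟩
  · have := xhat_add x s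
    have h : 0 ≤ xhat x s := by unfold xhat; positivity
    exact ⟨h, by omega⟩
  · exact Zq_congr r x (xhat x) b hlex (xhat_mono x) (dX_xhat x)
end SuZhang
end
end

section
/- Let Λ be a dominant regular integral weight for gl(m|n) with degree of atypicality r, let i_1,…,i_r be nonnegative integers, and suppose that μ = Λ − Σ_{s=1}^r i_s γ_s is regular and lexical. Let w ∈ W = Sym_m × Sym_n and let λ be a dominant weight with w(μ + ρ) = λ + ρ. Then (−1)^{i_1 + ⋯ + i_r} = (−1)^{ℓ(Λ,λ)} · ε(w), where ε(w) is the sign of the permutation w and ℓ(Λ,λ) = Σ_{s=1}^r (h_s(Λ) − h_s(λ)). -/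
open scoped Classical

noncomputable section

namespace SuZhang

theorem sign_aux (N : ℕ) (π : Equiv.Perm (Fin N)) (I : Finset (Fin N))
    (h : ∀ x y : Fin N, x < y → (x ∈ I ↔ y ∈ I) → π x < π y) :
    Equiv.Perm.sign π = ∏ x ∈ I, ((-1 : ℤˣ) ^ (x : ℕ) * (-1 : ℤˣ) ^ (π x : ℕ)) := by
  have key : ∀ a : Fin N, (-1 : ℤˣ) ^ (a : ℕ) = ∏ y : Fin N, if y < a then (-1 : ℤˣ) else 1 := by
    intro a
    rw [Finset.prod_ite]
    simp only [Finset.prod_const, one_pow, mul_one]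
    congr 1
    have : Finset.univ.filter (fun y => y < a) = Finset.Iio a := by ext; simp
    rw [this, Fin.card_Iio]
  let f : Fin N → Fin N → ℤˣ := fun x y =>
    (if y < x then (-1 : ℤˣ) else 1) * (if π y < π x then (-1 : ℤˣ) else 1)
  have hrhs : ∀ x : Fin N, ((-1 : ℤˣ) ^ (x : ℕ) * (-1 : ℤˣ) ^ (π x : ℕ)) = ∏ y, f x y := by
    intro x
    rw [key x, key (π x), Finset.prod_mul_distrib]
    congr 1
    exact (Equiv.prod_comp π (fun y => if y < π x then (-1 : ℤˣ) else 1)).symm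
  have hf1 : ∀ x y, (x ∈ I ↔ y ∈ I) → f x y = 1 := by
    intro x y hxy
    rcases lt_trichotomy x y with hl | rfl | hl
    · have := h x y hl hxy
      simp [f, hl.le.not_gt, this.le.not_gt]
    · simp [f]
    · have := h y x hl hxy.symm
      simp [f, hl, this]
  let F : Fin N → Fin N → ℤˣ := fun x y => if x ∈ I ∧ y ∉ I then f x y else 1
  have hF : ∀ x ∈ I, ∏ y, f x y = ∏ y, F x y := by
    intro x hx
    refine Finset.prod_congr rfl fun y _ => ?_
    by_cases hy : y ∈ I
    · simp only [F, hy, not_true, and_false, if_false]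
      exact hf1 x y (by simp [hx, hy])
    · simp [F, hx, hy]
  have hF2 : ∀ x ∉ I, ∏ y, F x y = 1 := by
    intro x hx
    simp [F, hx]
  have hR : ∏ x ∈ I, ((-1 : ℤˣ) ^ (x : ℕ) * (-1 : ℤˣ) ^ (π x : ℕ)) = ∏ x, ∏ y, F x y := by
    rw [← Finset.prod_subset (Finset.subset_univ I) (fun x _ hx => hF2 x hx)]
    exact Finset.prod_congr rfl fun x hx => by rw [hrhs, hF x hx]
  rw [hR, Equiv.Perm.sign_eq_prod_prod_Ioi]
  have hoff : ∏ x, ∏ y, F x y = ∏ x, ∏ y ∈ {x}ᶜ, F y x := by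
    rw [Finset.prod_comm]
    refine Finset.prod_congr rfl fun x _ => ?_
    symm
    refine Finset.prod_subset (Finset.subset_univ _) fun y _ hy => ?_
    have : y = x := by simpa using hy
    subst this
    simp [F]
  rw [hoff, ← Finset.prod_prod_Ioi_mul_eq_prod_prod_off_diag]
  refine Finset.prod_congr rfl fun x _ => Finset.prod_congr rfl fun y hy => ?_
  have hxy : x < y := by simpa using hy
  by_cases hx : x ∈ I <;> by_cases hy : y ∈ I
  · simp [F, hx, hy, h x y hxy (by simp [hx, hy])]
  · have hne : π x ≠ π y := fun e => hxy.ne (π.injective e)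
    rcases lt_or_gt_of_ne hne with hl | hl <;> simp [F, f, hx, hy, hxy.le.not_gt, hl, hl.le.not_gt]
  · have hne : π x ≠ π y := fun e => hxy.ne (π.injective e)
    rcases lt_or_gt_of_ne hne with hl | hl <;> simp [F, f, hx, hy, hxy, hl, hl.le.not_gt]
  · simp [F, hx, hy, h x y hxy (by simp [hx, hy])]

theorem sign_aux2 (N r : ℕ) (π : Equiv.Perm (Fin N)) (p q : Fin r → Fin N)
    (hp : Function.Injective p) (hpq : ∀ s, π (p s) = q s)
    (h1 : ∀ s t, p s < p t → q s < q t)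
    (h2 : ∀ x y : Fin N, x < y → (∀ s, p s ≠ x) → (∀ s, p s ≠ y) → π x < π y) :
    Equiv.Perm.sign π = (-1 : ℤˣ) ^ (∑ s, ((p s : ℕ) + (q s : ℕ))) := by
  rw [sign_aux N π (Finset.univ.image p), Finset.prod_image (fun a _ b _ e => hp e),
    ← Finset.prod_pow_eq_pow_sum]
  · exact Finset.prod_congr rfl fun s _ => by rw [hpq, pow_add]
  · intro x y hxy hI
    by_cases hx : x ∈ Finset.univ.image p
    · have hy := hI.1 hx
      simp only [Finset.mem_image, Finset.mem_univ, true_and] at hx hy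
      obtain ⟨s, rfl⟩ := hx
      obtain ⟨t, rfl⟩ := hy
      rw [hpq, hpq]
      exact h1 s t hxy
    · have hy := mt hI.2 hx
      simp only [Finset.mem_image, Finset.mem_univ, true_and, not_exists] at hx hy
      exact h2 x y hxy hx hy

theorem addV_idx {N r : ℕ} (w : Fin N → ℤ) (idx : Fin r → Fin N) (c : Fin r → ℤ)
    (h : Function.Injective idx) (s : Fin r) : addV w idx c (idx s) = w (idx s) + c s := by
  simp [addV, h.eq_iff]

theorem addV_not {N r : ℕ} (w : Fin N → ℤ) (idx : Fin r → Fin N) (c : Fin r → ℤ)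
    (x : Fin N) (h : ∀ s, idx s ≠ x) : addV w idx c x = w x := by
  simp [addV, h]

/-- formula (4.14): if `μ = Λ - Σ_s i_s γ_s` is regular and lexical, and
`w(μ + ρ) = λ + ρ` with `λ` dominant, then `(-1)^{Σ i_s} = (-1)^{ℓ(Λ,λ)} ε(w)`. -/
theorem statement17 (m n r : ℕ) (hm : 1 ≤ m) (hn : 1 ≤ n)
    (Le : Fin m → ℤ) (Ld : Fin n → ℤ)
    (hLdom : Dominant m Le Ld) (hLreg : Regular m Le Ld)
    (mI : Fin r → Fin m) (nI : Fin r → Fin n) (hLEnum : Enum m n r Le Ld mI nI)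
    (i : Fin r → ℕ)
    -- μ = Λ - Σ_s i_s γ_s
    (μe : Fin m → ℤ) (μd : Fin n → ℤ)
    (hμe : μe = addV Le mI fun s => -(i s : ℤ))
    (hμd : μd = addV Ld nI fun s => -(i s : ℤ))
    (hμreg : Regular m μe μd)
    (hμlex : Lexical μd nI)
    -- λ dominant with w(μ + ρ) = λ + ρ, where w = (πe, πd) ∈ W = Sym_m × Sym_n
    (le : Fin m → ℤ) (ld : Fin n → ℤ)
    (hldom : Dominant m le ld) (hlreg : Regular m le ld)
    (πe : Equiv.Perm (Fin m)) (πd : Equiv.Perm (Fin n))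
    (hwE : ∀ j : Fin m, rE m le j = rE m μe (πe j))
    (hwD : ∀ ζ : Fin n, rD ld ζ = rD μd (πd ζ))
    -- the atypical enumeration of λ
    (mI' : Fin r → Fin m) (nI' : Fin r → Fin n) (hlEnum : Enum m n r le ld mI' nI') :
    ((-1 : ℤˣ) ^ (∑ s, i s))
      = (-1 : ℤˣ) ^ (lenDiff Le mI nI le mI' nI')
        * (Equiv.Perm.sign πe * Equiv.Perm.sign πd) := by
  have hmIinj : Function.Injective mI := fun a b e => by
    rcases lt_trichotomy a b with h | h | h
    · exact absurd e (hLEnum.mAnti _ _ h).ne'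
    · exact h
    · exact absurd e (hLEnum.mAnti _ _ h).ne
  have hmIinj' : Function.Injective mI' := fun a b e => by
    rcases lt_trichotomy a b with h | h | h
    · exact absurd e (hlEnum.mAnti _ _ h).ne'
    · exact h
    · exact absurd e (hlEnum.mAnti _ _ h).ne
  have hnIm : StrictMono nI := fun a b h => hLEnum.nMono a b h
  have hnIm' : StrictMono nI' := fun a b h => hlEnum.nMono a b h
  have hnIinj := hnIm.injective
  have hEi : ∀ s, rE m μe (mI s) = rE m Le (mI s) - i s := fun s => by
    simp only [rE, hμe, addV_idx _ _ _ hmIinj]; ring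
  have hDi : ∀ s, rD μd (nI s) = rD Ld (nI s) - i s := fun s => by
    simp only [rD, hμd, addV_idx _ _ _ hnIinj]; ring
  have hEn : ∀ x, (∀ s, mI s ≠ x) → rE m μe x = rE m Le x := fun x hx => by
    simp only [rE, hμe, addV_not _ _ _ _ hx]
  have hDn : ∀ x, (∀ s, nI s ≠ x) → rD μd x = rD Ld x := fun x hx => by
    simp only [rD, hμd, addV_not _ _ _ _ hx]
  have hED : ∀ s, rE m μe (mI s) = rD μd (nI s) := fun s => by
    rw [hEi, hDi, hLEnum.atyp]
  have hLE : ∀ x y : Fin m, x < y → rE m Le y < rE m Le x := fun x y h => by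
    have := hLdom.1 x y h.le
    have h' : (x : ℕ) < y := h
    simp only [rE]; omega
  have hLD : ∀ x y : Fin n, x < y → rD Ld x < rD Ld y := fun x y h => by
    have := hLdom.2 x y h.le
    have h' : (x : ℕ) < y := h
    simp only [rD]; omega
  have hlE : ∀ x y : Fin m, x < y → rE m le y < rE m le x := fun x y h => by
    have := hldom.1 x y h.le
    have h' : (x : ℕ) < y := h
    simp only [rE]; omega
  have hlD : ∀ x y : Fin n, x < y → rD ld x < rD ld y := fun x y h => by
    have := hldom.2 x y h.le
    have h' : (x : ℕ) < y := h
    simp only [rD]; omega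
  have hτ : ∀ s, ∃ t, πe (mI' s) = mI t ∧ πd (nI' s) = nI t := by
    intro s
    have e : rE m μe (πe (mI' s)) = rD μd (πd (nI' s)) := by
      rw [← hwE, ← hwD, hlEnum.atyp]
    by_cases h1 : ∃ t, mI t = πe (mI' s)
    · obtain ⟨t, ht⟩ := h1
      refine ⟨t, ht.symm, hμreg.2 ?_⟩
      rw [← e, ← ht, hED]
    · by_cases h2 : ∃ t, nI t = πd (nI' s)
      · obtain ⟨t, ht⟩ := h2
        refine ⟨t, hμreg.1 ?_, ht.symm⟩
        rw [e, ← ht, hED]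
      · push Not at h1 h2
        rw [hEn _ h1, hDn _ h2] at e
        obtain ⟨t, ht, _⟩ := hLEnum.complete _ _ e
        exact absurd ht (h1 t)
  choose τ hτ1 hτ2 using hτ
  have hτm : StrictMono τ := by
    intro s t hst
    by_contra hc
    have h1 := hμlex (not_lt.1 hc)
    have h2 := hlD _ _ (hnIm' hst)
    simp only at h1
    rw [hwD, hwD, hτ2, hτ2] at h2
    omega
  have hτid : τ = id := by
    apply (StrictMono.range_inj hτm strictMono_id).1
    rw [(Finite.surjective_of_injective hτm.injective).range_eq, Set.range_id]
  subst hτid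
  simp only [id] at hτ1 hτ2
  have sE := sign_aux2 m r πe mI' mI hmIinj' hτ1
    (fun s t h => by
      rcases lt_trichotomy s t with h' | h' | h'
      · exact absurd h (hlEnum.mAnti _ _ h').le.not_gt
      · subst h'; exact absurd h (lt_irrefl _)
      · exact hLEnum.mAnti _ _ h')
    (fun x y h hx hy => by
      have hx' : ∀ s, mI s ≠ πe x := fun s e => hx s (πe.injective ((hτ1 s).trans e))
      have hy' : ∀ s, mI s ≠ πe y := fun s e => hy s (πe.injective ((hτ1 s).trans e))
      have h2 := hlE _ _ h
      rw [hwE, hwE, hEn _ hx', hEn _ hy'] at h2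
      rcases lt_trichotomy (πe x) (πe y) with h' | h' | h'
      · exact h'
      · rw [h'] at h2; exact absurd h2 (lt_irrefl _)
      · exact absurd h2 (hLE _ _ h').le.not_gt)
  have sD := sign_aux2 n r πd nI' nI hnIm'.injective hτ2
    (fun s t h => hnIm (hnIm'.lt_iff_lt.1 h))
    (fun x y h hx hy => by
      have hx' : ∀ s, nI s ≠ πd x := fun s e => hx s (πd.injective ((hτ2 s).trans e))
      have hy' : ∀ s, nI s ≠ πd y := fun s e => hy s (πd.injective ((hτ2 s).trans e))
      have h2 := hlD _ _ h
      rw [hwD, hwD, hDn _ hx', hDn _ hy'] at h2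
      rcases lt_trichotomy (πd x) (πd y) with h' | h' | h'
      · exact h'
      · rw [h'] at h2; exact absurd h2 (lt_irrefl _)
      · exact absurd h2 (hLD _ _ h').le.not_gt)
  have hlen : lenDiff Le mI nI le mI' nI'
      = ∑ s, ((i s : ℤ) + ((mI s : ℕ) : ℤ) - (mI' s : ℕ) - (nI s : ℕ) + (nI' s : ℕ)) := by
    refine Finset.sum_congr rfl fun s _ => ?_
    have e := hwE (mI' s)
    rw [hτ1, hEi] at e
    simp only [rE] at e
    simp only [height]
    linarith
  rw [sE, sD, ← zpow_natCast, ← zpow_natCast, ← zpow_natCast, ← zpow_add, ← zpow_add, hlen]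
  change Int.negOnePow _ = Int.negOnePow _
  rw [Int.negOnePow_eq_iff]
  push_cast
  rw [← Finset.sum_add_distrib, ← Finset.sum_add_distrib, ← Finset.sum_sub_distrib]
  refine Finset.even_sum _ fun s _ => ?_
  exact ⟨-(mI s : ℤ) - (nI' s : ℤ), by ring⟩
end SuZhang
end
end
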